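/- arXiv:2509.23817 — 2 statements merged into one kernel-verified Lean document; each statement's English description precedes it below -/
import Mathlib

section
/- (Opial's lemma) Let H be a real Hilbert space, {x_k} a sequence in H, and B ⊆ H a nonempty set. Suppose that: (1) for every y ∈ B, the sequence {‖x_k − y‖} converges; (2) every weak cluster point of {x_k} belongs to B. Then {x_k} converges weakly to some point x̄ ∈ B. -/
open Filter RealInnerProductSpace

/-- Weak convergence of a sequence in a real inner product space, characterized by
convergence of inner products against every vector. -/
def WeaklyConvergesTo {H : Type*} [NormedAddCommGroup H] [InnerProductSpace ℝ H]
    (x : ℕ → H) (l : H) : Prop :=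
  ∀ q : H, Tendsto (fun k => ⟪x k, q⟫) atTop (nhds ⟪l, q⟫)

/-- A bounded sequence in a Hilbert space has a weakly convergent subsequence. -/
theorem exists_weaklyConvergesTo_subseq_of_bounded
    {H : Type*} [NormedAddCommGroup H] [InnerProductSpace ℝ H] [CompleteSpace H]
    {x : ℕ → H} {C : ℝ} (hC : ∀ k, ‖x k‖ ≤ C) :
    ∃ z : H, ∃ φ : ℕ → ℕ, StrictMono φ ∧ WeaklyConvergesTo (x ∘ φ) z := by
  let K : Submodule ℝ H := (Submodule.span ℝ (Set.range x)).topologicalClosure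
  have hxK : ∀ k, x k ∈ K := fun k =>
    Submodule.le_topologicalClosure _ (Submodule.subset_span ⟨k, rfl⟩)
  have hsep : TopologicalSpace.SeparableSpace K :=
    ((Set.countable_range x).isSeparable.span (R := ℝ)).closure.separableSpace
  have : CompleteSpace K :=
    (Submodule.isClosed_topologicalClosure _).completeSpace_coe
  let y : ℕ → K := fun k => ⟨x k, hxK k⟩
  obtain ⟨g, -, φ, hφ, hg⟩ := WeakDual.isSeqCompact_closedBall ℝ K 0 C
    (x := fun k => StrongDual.toWeakDual (InnerProductSpace.toDual ℝ K (y k)))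
    (fun k => by
      change InnerProductSpace.toDual ℝ K (y k) ∈ Metric.closedBall 0 C
      simpa [y] using hC k)
  refine ⟨((InnerProductSpace.toDual ℝ K).symm (WeakDual.toStrongDual g) : K), φ, hφ,
    fun q => ?_⟩
  have h := ((WeakDual.eval_continuous (K.orthogonalProjectionOnto q)).tendsto g).comp hg
  have hproj : ∀ u : K, ⟪u, K.orthogonalProjectionOnto q⟫ = ⟪(u : H), q⟫ := fun u =>
    K.inner_orthogonalProjectionOnto_eq_of_mem_left u q
  rw [← hproj, InnerProductSpace.toDual_symm_apply]
  refine h.congr fun k => ?_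
  exact hproj (y (φ k))

/-- If the distances from a sequence to `y` and to `z` both converge, then `y` and `z` coincide
as soon as both are weak limits along maps tending to infinity. -/
theorem WeaklyConvergesTo.eq_of_tendsto_norm_sub
    {H : Type*} [NormedAddCommGroup H] [InnerProductSpace ℝ H]
    {x : ℕ → H} {y z : H} {a b : ℝ}
    (ha : Tendsto (fun k => ‖x k - y‖) atTop (nhds a))
    (hb : Tendsto (fun k => ‖x k - z‖) atTop (nhds b))
    {φ ψ : ℕ → ℕ} (hφ : Tendsto φ atTop atTop) (hψ : Tendsto ψ atTop atTop)
    (hy : WeaklyConvergesTo (x ∘ φ) y) (hz : WeaklyConvergesTo (x ∘ ψ) z) : y = z := by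
  have h : Tendsto (fun k => ⟪x k, y - z⟫) atTop
      (nhds ((b ^ 2 - a ^ 2 + ‖y‖ ^ 2 - ‖z‖ ^ 2) / 2)) := by
    refine (((((hb.pow 2).sub (ha.pow 2)).add_const (‖y‖ ^ 2)).sub_const (‖z‖ ^ 2)).div_const
      2).congr fun k => ?_
    rw [norm_sub_sq_real, norm_sub_sq_real, inner_sub_right]
    ring
  have h₁ := tendsto_nhds_unique (hy (y - z)) (h.comp hφ)
  have h₂ := tendsto_nhds_unique (hz (y - z)) (h.comp hψ)
  rw [← sub_eq_zero, ← inner_self_eq_zero (𝕜 := ℝ), inner_sub_left, h₁, h₂, sub_self]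

/-- Opial's lemma: let `{x_k}` be a sequence in a real Hilbert space `H`
and `B ⊆ H` nonempty. If (1) for every `y ∈ B` the sequence `{‖x_k - y‖}` converges, and
(2) every weak cluster point of `{x_k}` belongs to `B`, then `{x_k}` converges weakly to
some `x̄ ∈ B`. -/
theorem opial_lemma
    {H : Type*} [NormedAddCommGroup H] [InnerProductSpace ℝ H] [CompleteSpace H]
    (x : ℕ → H) (B : Set H) (hBne : B.Nonempty)
    (hdist : ∀ y ∈ B, ∃ L : ℝ, Tendsto (fun k => ‖x k - y‖) atTop (nhds L))
    (hcluster : ∀ z : H, (∃ φ : ℕ → ℕ, StrictMono φ ∧ WeaklyConvergesTo (x ∘ φ) z) → z ∈ B) :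
    ∃ xbar ∈ B, WeaklyConvergesTo x xbar := by
  obtain ⟨y₀, hy₀⟩ := hBne
  obtain ⟨L, hL⟩ := hdist y₀ hy₀
  obtain ⟨C, hC⟩ := hL.bddAbove_range
  have hbound : ∀ k, ‖x k‖ ≤ C + ‖y₀‖ := fun k => by
    have h₁ : ‖x k - y₀‖ ≤ C := hC ⟨k, rfl⟩
    have h₂ := norm_sub_norm_le (x k) y₀
    linarith
  obtain ⟨z, φ, hφ, hz⟩ := exists_weaklyConvergesTo_subseq_of_bounded hbound
  have hzB := hcluster z ⟨φ, hφ, hz⟩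
  refine ⟨z, hzB, fun q => tendsto_of_subseq_tendsto fun ns hns => ?_⟩
  obtain ⟨θ, hθ, hnsθ⟩ := strictMono_subseq_of_tendsto_atTop hns
  obtain ⟨w, ψ, hψ, hw⟩ :=
    exists_weaklyConvergesTo_subseq_of_bounded (x := x ∘ (ns ∘ θ)) fun k => hbound (ns (θ k))
  have hmono : StrictMono (ns ∘ θ ∘ ψ) := hnsθ.comp hψ
  have hwB := hcluster w ⟨_, hmono, hw⟩
  obtain ⟨a, ha⟩ := hdist z hzB
  obtain ⟨b, hb⟩ := hdist w hwB
  obtain rfl := WeaklyConvergesTo.eq_of_tendsto_norm_sub ha hb hφ.tendsto_atTop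
    hmono.tendsto_atTop hz hw
  exact ⟨θ ∘ ψ, hw q⟩
end

section
/- (Theorem 2) Let H be a real Hilbert space, C ⊆ H nonempty closed convex, and F, G : H × H → ℝ bifunctions on C with F satisfying (C1)–(C5), G satisfying (C1)–(C3), and G strongly monotone: there exists ρ > 0 with G(x,y) + G(y,x) ≤ −ρ‖x − y‖² for all x, y ∈ C. Assume the hierarchical solution set S = {x̄ ∈ S_F : G(x̄, y) ≥ 0 for all y ∈ S_F} is nonempty; assume (H2): for every x ∈ C there exists ξ ∈ H with G(x, u) ≥ ⟨ξ, u − x⟩ for all u ∈ C; and assume (H3): the set {t(c − s) : t > 0, c ∈ C, s ∈ S_F} is a closed linear subspace of H. Let {r_k} be positive with ∑_k r_k = +∞ and ∑_k r_k² < +∞, let {λ_k} be positive, and let {γ_k} ⊆ [0, 1/2]. Assume that for every x̄ ∈ S and every p ∈ H with ⟨p, w − x̄⟩ ≤ 0 for all w ∈ S_F, there exists a nonnegative sequence {ω_k} with limsup_{k→∞} λ_k ω_k ≤ 0 and F(v, x̄) + (2/λ_k)⟨p, v − x̄⟩ ≤ ω_k for all k and all v ∈ C. Let x₀, x₁ ∈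 C and, for k ≥ 1, let y_k = (1−γ_k) x_k + γ_k x_{k−1}, let u_k ∈ C be a resolvent point of G at y_k with parameter r_k, and let x_{k+1} ∈ C be a resolvent point of F at u_k with parameter r_k λ_k. Then S is a singleton {x̄} and the sequence {x_k} converges strongly in H to x̄. -/
open Filter RealInnerProductSpace

lemma tendsto_zero_of_two_step_contraction {a r γ : ℕ → ℝ} {ρ : ℝ} (hρ : 0 < ρ)
    (ha : ∀ k, 0 ≤ a k) (hr : ∀ k, 0 ≤ r k) (hrs : ¬ Summable r)
    (hγ : ∀ k, γ k ∈ Set.Icc (0 : ℝ) (1 / 2))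
    (h : ∀ k, (1 + ρ * r k) * a (k + 2) ≤ (1 - γ k) * a (k + 1) + γ k * a k) :
    Tendsto a atTop (nhds 0) := by
  set m : ℕ → ℝ := fun k => max (a k - a (k + 1)) 0 with hm
  set q : ℕ → ℝ := fun k => max (a (k + 1) - a k) 0 with hq
  have hm0 : ∀ k, 0 ≤ m k := fun k => le_max_right _ _
  have hq0 : ∀ k, 0 ≤ q k := fun k => le_max_right _ _
  have hm1 : ∀ k, a k - a (k + 1) ≤ m k := fun k => le_max_left _ _
  have hqm : ∀ k, q k - m k = a (k + 1) - a k := by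
    intro k
    simp only [hm, hq]
    rcases le_total (a k) (a (k + 1)) with h | h
    · rw [max_eq_left (by linarith), max_eq_right (by linarith)]; ring
    · rw [max_eq_right (by linarith), max_eq_left (by linarith)]; ring
  have hγm : ∀ k, γ k * (a k - a (k + 1)) ≤ 1 / 2 * m k := fun k =>
    (mul_le_mul_of_nonneg_left (hm1 k) (hγ k).1).trans
      (mul_le_mul_of_nonneg_right (hγ k).2 (hm0 k))
  have hra : ∀ k, 0 ≤ ρ * r k * a (k + 2) := fun k =>
    mul_nonneg (mul_nonneg hρ.le (hr k)) (ha _)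
  have hqle : ∀ k, q (k + 1) ≤ 1 / 2 * m k := fun k =>
    max_le (by linarith [h k, hγm k, hra k]) (by linarith [hm0 k])
  have hsum : ∀ n, ∑ k ∈ Finset.range n, q k ≤ q 0 + 1 / 2 * ∑ k ∈ Finset.range n, m k := by
    intro n
    cases n with
    | zero => simpa using hq0 0
    | succ n =>
      rw [Finset.sum_range_succ', Finset.sum_range_succ]
      have : ∑ k ∈ Finset.range n, q (k + 1) ≤ 1 / 2 * ∑ k ∈ Finset.range n, m k := by
        rw [Finset.mul_sum]; exact Finset.sum_le_sum fun k _ => hqle k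
      linarith [hm0 n]
  have htel : ∀ n, ∑ k ∈ Finset.range n, q k - ∑ k ∈ Finset.range n, m k = a n - a 0 := by
    intro n
    rw [← Finset.sum_sub_distrib, Finset.sum_congr rfl fun k _ => hqm k, Finset.sum_range_sub]
  have hms : Summable m := summable_of_sum_range_le (c := 2 * (a 0 + q 0)) hm0 fun n => by
    linarith [hsum n, htel n, ha n]
  have hqs : Summable q := (summable_nat_add_iff 1).1 <|
    Summable.of_nonneg_of_le (fun k => hq0 _) hqle (hms.mul_left _)
  obtain ⟨L, hL⟩ : ∃ L, Tendsto a atTop (nhds L) := by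
    refine ⟨_, ((hqs.hasSum.tendsto_sum_nat.sub hms.hasSum.tendsto_sum_nat).add_const
      (a 0)).congr fun n => ?_⟩
    linarith [htel n]
  have hras : Summable fun k => ρ * r k * a (k + 2) :=
    Summable.of_nonneg_of_le hra (fun k => by linarith [h k, hγm k, hm1 (k + 1)])
      (((summable_nat_add_iff 1).2 hms).add (hms.mul_left (1 / 2)))
  have hL0 : 0 ≤ L := ge_of_tendsto' hL ha
  rcases hL0.eq_or_lt with rfl | hLpos
  · exact hL
  refine absurd ?_ hrs
  obtain ⟨N, hN⟩ := eventually_atTop.1 (hL.eventually (lt_mem_nhds (half_lt_self hLpos)))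
  refine (summable_nat_add_iff N).1 (Summable.of_nonneg_of_le (fun k => hr _) (fun k => ?_)
    (((summable_nat_add_iff N).2 hras).mul_left (1 / (ρ * (L / 2)))))
  have h1 : ρ * r (k + N) * (L / 2) ≤ ρ * r (k + N) * a (k + N + 2) :=
    mul_le_mul_of_nonneg_left (hN _ (by omega)).le (mul_nonneg hρ.le (hr _))
  rw [one_div, inv_mul_eq_div, le_div_iff₀ (by positivity)]
  linarith

lemma tendsto_zero_of_two_step_perturbed {e r γ ε : ℕ → ℝ} {ρ : ℝ} (hρ : 0 < ρ)
    (he : ∀ k, 0 ≤ e k) (hr : ∀ k, 0 ≤ r k) (hrs : ¬ Summable r)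
    (hγ : ∀ k, γ k ∈ Set.Icc (0 : ℝ) (1 / 2))
    (hε : ∀ δ > 0, ∀ᶠ k in atTop, ε k ≤ δ)
    (h : ∀ᶠ k in atTop,
      (1 + ρ * r k) * e (k + 2) ≤ (1 - γ k) * e (k + 1) + γ k * e k + r k * ε k) :
    Tendsto e atTop (nhds 0) := by
  refine tendsto_order.2 ⟨fun b hb => Eventually.of_forall fun k => hb.trans_le (he k),
    fun b hb => ?_⟩
  set η := b / 2 with hη
  obtain ⟨N, hN⟩ := eventually_atTop.1 (h.and (hε (ρ * η) (by positivity)))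
  set a : ℕ → ℝ := fun k => max (e k - η) 0 with ha
  have key : Tendsto (fun k => a (k + N)) atTop (nhds 0) := by
    refine tendsto_zero_of_two_step_contraction (r := fun k => r (k + N))
      (γ := fun k => γ (k + N)) hρ (fun k => le_max_right _ _) (fun k => hr _)
      (fun hs => hrs ((summable_nat_add_iff N).1 hs)) (fun k => hγ _) fun k => ?_
    obtain ⟨h1, h2⟩ := hN (k + N) (by omega)
    obtain ⟨hγ0, hγ1⟩ := hγ (k + N)
    have e1 : k + 2 + N = k + N + 2 := by omega
    have e2 : k + 1 + N = k + N + 1 := by omega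
    simp only [e1, e2]
    have h3 : r (k + N) * ε (k + N) ≤ r (k + N) * (ρ * η) :=
      mul_le_mul_of_nonneg_left h2 (hr _)
    have h4 : (1 - γ (k + N)) * (e (k + N + 1) - η) ≤ (1 - γ (k + N)) * a (k + N + 1) :=
      mul_le_mul_of_nonneg_left (le_max_left _ _) (by linarith)
    have h5 : γ (k + N) * (e (k + N) - η) ≤ γ (k + N) * a (k + N) :=
      mul_le_mul_of_nonneg_left (le_max_left _ _) hγ0
    have h6 : 0 ≤ (1 - γ (k + N)) * a (k + N + 1) :=
      mul_nonneg (by linarith) (le_max_right _ _)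
    have h7 : 0 ≤ γ (k + N) * a (k + N) := mul_nonneg hγ0 (le_max_right _ _)
    rcases le_total (e (k + N + 2) - η) 0 with hc | hc
    · have : a (k + N + 2) = 0 := max_eq_right hc
      rw [this]; linarith
    · have : a (k + N + 2) = e (k + N + 2) - η := max_eq_left hc
      rw [this]; linarith
  have := ((tendsto_add_atTop_iff_nat N).1 key).eventually (gt_mem_nhds (show 0 < η by positivity))
  filter_upwards [this] with k hk
  have : e k - η ≤ a k := le_max_left _ _
  linarith

section OpenImage

open scoped Pointwise

variable {X Y : Type*} [NormedAddCommGroup X] [NormedSpace ℝ X] [CompleteSpace X]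
  [NormedAddCommGroup Y] [NormedSpace ℝ Y]

lemma ball_subset_image_of_ball_subset_closure_image (T : X →L[ℝ] Y) {K : Set X}
    (hKcv : Convex ℝ K) (hKcl : IsClosed K) (hKb : Bornology.IsBounded K) {δ : ℝ}
    (h : Metric.ball 0 δ ⊆ closure (T '' K)) : Metric.ball 0 (δ / 2) ⊆ T '' K := by
  intro v hv
  have hδ : 0 < δ / 2 := Metric.pos_of_mem_ball hv
  have step : ∀ w : Y, ∃ k : X, ‖w‖ < δ / 2 → k ∈ K ∧ ‖(2 : ℝ) • w - T k‖ < δ / 2 := by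
    intro w
    by_cases hw : ‖w‖ < δ / 2
    · have h2 : (2 : ℝ) • w ∈ Metric.ball (0 : Y) δ := by
        rw [mem_ball_zero_iff, norm_smul, Real.norm_two]; linarith
      obtain ⟨_, ⟨k, hk, rfl⟩, hd⟩ := Metric.mem_closure_iff.1 (h h2) (δ / 2) hδ
      exact ⟨k, fun _ => ⟨hk, by rwa [← dist_eq_norm]⟩⟩
    · exact ⟨0, fun h' => absurd h' hw⟩
  choose κ hκ using step
  let w : ℕ → Y := fun n => Nat.rec v (fun _ w => (2 : ℝ) • w - T (κ w)) n
  have hw_succ : ∀ n, w (n + 1) = (2 : ℝ) • w n - T (κ (w n)) := fun n => rfl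
  have hw : ∀ n, ‖w n‖ < δ / 2 := by
    intro n
    induction n with
    | zero => exact mem_ball_zero_iff.1 hv
    | succ n ih => rw [hw_succ]; exact (hκ _ ih).2
  have hk : ∀ n, κ (w n) ∈ K := fun n => (hκ _ (hw n)).1
  let s : ℕ → X := fun n => ∑ i ∈ Finset.range n, (1 / 2 : ℝ) ^ (i + 1) • κ (w i)
  have hs_succ : ∀ n, s (n + 1) = s n + (1 / 2 : ℝ) ^ (n + 1) • κ (w n) :=
    fun n => Finset.sum_range_succ _ _
  have hsK : ∀ n, ∀ z ∈ K, s n + (1 / 2 : ℝ) ^ n • z ∈ K := by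
    intro n
    induction n with
    | zero => intro z hz; simpa [s] using hz
    | succ n ih =>
      intro z hz
      have := ih _ (hKcv (hk n) hz (by norm_num : (0 : ℝ) ≤ 1 / 2)
        (by norm_num : (0 : ℝ) ≤ 1 / 2) (by norm_num))
      convert this using 1
      rw [hs_succ, smul_add, smul_smul, smul_smul, ← pow_succ, add_assoc]
  have hTs : ∀ n, T (s n) = v - (1 / 2 : ℝ) ^ n • w n := by
    intro n
    induction n with
    | zero => simp [s, w]
    | succ n ih =>
      rw [hs_succ, map_add, ih, map_smul, hw_succ, pow_succ]
      module
  obtain ⟨R, hR⟩ := hKb.exists_norm_le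
  have hpow : Tendsto (fun n : ℕ => (1 / 2 : ℝ) ^ n) atTop (nhds 0) :=
    tendsto_pow_atTop_nhds_zero_of_lt_one (by norm_num) (by norm_num)
  have hsum : Summable fun i => (1 / 2 : ℝ) ^ (i + 1) • κ (w i) := by
    refine Summable.of_norm_bounded (g := fun i => (1 / 2 : ℝ) ^ (i + 1) * R) ?_ fun i => ?_
    · exact ((summable_nat_add_iff 1).2 summable_geometric_two).mul_right R
    · rw [norm_smul, Real.norm_of_nonneg (by positivity)]
      exact mul_le_mul_of_nonneg_left (hR _ (hk i)) (by positivity)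
  have hlim := hsum.hasSum.tendsto_sum_nat
  refine ⟨∑' i, (1 / 2 : ℝ) ^ (i + 1) • κ (w i),
    hKcl.mem_of_tendsto (f := fun n => s n + (1 / 2 : ℝ) ^ n • κ (w 0)) (b := atTop) ?_
      (Eventually.of_forall fun n => hsK n _ (hk 0)), ?_⟩
  · simpa only [zero_smul, add_zero] using hlim.add (hpow.smul_const (κ (w 0)))
  · refine tendsto_nhds_unique ((T.continuous.tendsto _).comp hlim) ?_
    have h0 : Tendsto (fun n => (1 / 2 : ℝ) ^ n • w n) atTop (nhds 0) := by
      refine squeeze_zero_norm (a := fun n => (1 / 2 : ℝ) ^ n * (δ / 2)) (fun n => ?_) ?_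
      · rw [norm_smul, Real.norm_of_nonneg (by positivity)]
        exact mul_le_mul_of_nonneg_left (hw n).le (by positivity)
      · simpa using hpow.mul_const (δ / 2)
    have := (tendsto_const_nhds (x := v)).sub h0
    rw [sub_zero] at this
    exact this.congr fun n => (hTs n).symm

lemma exists_ball_subset_image_of_absorbing [CompleteSpace Y] (T : X →L[ℝ] Y) {K : ℕ → Set X}
    (hKmono : Monotone K) (hK0 : 0 ∈ K 0) (hKcv : ∀ n, Convex ℝ (K n))
    (hKcl : ∀ n, IsClosed (K n)) (hKb : ∀ n, Bornology.IsBounded (K n))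
    (h : ∀ v : Y, ∃ n, ∃ t : ℝ, 0 < t ∧ ∃ k ∈ K n, v = t • T k) :
    ∃ n, ∃ δ > 0, Metric.ball 0 δ ⊆ T '' K n := by
  have hcv : ∀ n, Convex ℝ (closure (T '' K n)) := fun n =>
    ((hKcv n).linear_image T.toLinearMap).closure
  obtain ⟨N, hN⟩ := nonempty_interior_of_iUnion_of_closed
    (f := fun n : ℕ => ((n : ℝ) + 1) • closure (T '' K n))
    (fun n => isClosed_closure.smul_of_ne_zero (by positivity)) (by
      refine Set.eq_univ_of_forall fun v => ?_
      obtain ⟨n, t, ht, k, hk, rfl⟩ := h v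
      obtain ⟨m, hm⟩ := exists_nat_ge t
      have hpos : (0 : ℝ) < (max n m : ℕ) + 1 := by positivity
      have htm : t ≤ (max n m : ℕ) + 1 := by
        have : (m : ℝ) ≤ (max n m : ℕ) := by exact_mod_cast le_max_right n m
        linarith
      refine Set.mem_iUnion.2 ⟨max n m, T ((t / ((max n m : ℕ) + 1)) • k),
        subset_closure ⟨_, ?_, rfl⟩, ?_⟩
      · exact (hKcv _).smul_mem_of_zero_mem (hKmono (Nat.zero_le _) hK0)
          (hKmono (le_max_left _ _) hk) ⟨by positivity, (div_le_one hpos).2 htm⟩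
      · simp only [map_smul, smul_smul]
        rw [mul_div_cancel₀ _ hpos.ne'])
  rw [interior_smul₀ (by positivity)] at hN
  obtain ⟨z, hz⟩ := Set.smul_set_nonempty.1 hN
  obtain ⟨ε, hε, hball⟩ := Metric.isOpen_iff.1 isOpen_interior z hz
  obtain ⟨m, t, ht, k, hk, hzk⟩ := h (-z)
  have hsub : ∀ {i}, i ≤ max N m → closure (T '' K i) ⊆ closure (T '' K (max N m)) :=
    fun hi => closure_mono (Set.image_mono (hKmono hi))
  refine ⟨max N m, ε / (1 + t) / 2, by positivity,
    ball_subset_image_of_ball_subset_closure_image T (hKcv _) (hKcl _) (hKb _) fun v hv => ?_⟩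
  have h1 : z + (1 + t) • v ∈ closure (T '' K (max N m)) := by
    refine hsub (le_max_left _ _) (interior_subset (hball ?_))
    rw [mem_ball_zero_iff, lt_div_iff₀ (by positivity)] at hv
    rw [Metric.mem_ball, dist_eq_norm, add_sub_cancel_left, norm_smul,
      Real.norm_of_nonneg (by positivity)]
    linarith
  have h2 : T k ∈ closure (T '' K (max N m)) :=
    hsub (le_max_right _ _) (subset_closure ⟨k, hk, rfl⟩)
  have h3 := hcv _ h1 h2 (show (0 : ℝ) ≤ 1 / (1 + t) by positivity)
    (show (0 : ℝ) ≤ t / (1 + t) by positivity) (by field_simp)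
  convert h3 using 1
  have : z = -(t • T k) := by rw [← hzk, neg_neg]
  rw [this, smul_add, smul_smul, one_div_mul_cancel (by positivity), one_smul, smul_neg, smul_smul,
    div_mul_eq_mul_div, one_mul]
  abel

end OpenImage

lemma exists_dual_of_absorbing {E : Type*} [NormedAddCommGroup E] [NormedSpace ℝ E]
    [CompleteSpace E] {C D : Set E} {φ : E → ℝ} (hCcl : IsClosed C)
    (hDcl : IsClosed D) (hDcv : Convex ℝ D) (hφcv : ConvexOn ℝ C φ)
    (hφlsc : LowerSemicontinuousOn φ C) (hC0 : 0 ∈ C) (hD0 : 0 ∈ D) (hφ0 : φ 0 = 0)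
    (hφnn : ∀ v ∈ C ∩ D, 0 ≤ φ v)
    (habs : ∀ v : E, ∃ t : ℝ, 0 < t ∧ ∃ c ∈ C, ∃ d ∈ D, v = t • (c - d)) :
    ∃ f : StrongDual ℝ E, (∀ d ∈ D, f d ≤ 0) ∧ ∀ c ∈ C, 0 ≤ φ c + f c := by
  let T : E × E →L[ℝ] E := ContinuousLinearMap.fst ℝ E E - ContinuousLinearMap.snd ℝ E E
  let K : ℕ → Set (E × E) := fun n =>
    {c | c ∈ C ∧ φ c ≤ n} ×ˢ D ∩ Metric.closedBall 0 n
  have hsubcl : ∀ b : ℝ, IsClosed {c | c ∈ C ∧ φ c ≤ b} := fun b => by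
    obtain ⟨v, hv, hCv⟩ := lowerSemicontinuousOn_iff_preimage_Iic.1 hφlsc b
    have : {c | c ∈ C ∧ φ c ≤ b} = C ∩ v := hCv
    rw [this]; exact hCcl.inter hv
  obtain ⟨N, δ, hδ, hball⟩ := exists_ball_subset_image_of_absorbing T (K := K)
    (fun i j hij p hp => ⟨⟨⟨hp.1.1.1, hp.1.1.2.trans (by exact_mod_cast hij)⟩, hp.1.2⟩,
      Metric.closedBall_subset_closedBall (by exact_mod_cast hij) hp.2⟩)
    (by simp [K, hC0, hD0, hφ0])
    (fun n => ((hφcv.convex_le n).prod hDcv).inter (convex_closedBall _ _))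
    (fun n => ((hsubcl n).prod hDcl).inter Metric.isClosed_closedBall)
    (fun n => Metric.isBounded_closedBall.subset Set.inter_subset_right)
    (fun v => by
      obtain ⟨t, ht, c, hc, d, hd, rfl⟩ := habs v
      obtain ⟨n, hn⟩ := exists_nat_ge (max (φ c) ‖(c, d)‖)
      exact ⟨n, t, ht, (c, d), ⟨⟨⟨hc, (le_max_left _ _).trans hn⟩, hd⟩,
        mem_closedBall_zero_iff.2 ((le_max_right _ _).trans hn)⟩, rfl⟩)
  let P : Set (E × ℝ) := {z | ∃ c ∈ C, ∃ d ∈ D, c - d = z.1 ∧ φ c < z.2}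
  have hPcv : Convex ℝ P := by
    rintro ⟨_, a⟩ ⟨c, hc, d, hd, rfl, hca⟩ ⟨_, a'⟩ ⟨c', hc', d', hd', rfl, hca'⟩ s t hs ht hst
    refine ⟨s • c + t • c', hφcv.1 hc hc' hs ht hst, s • d + t • d', hDcv hd hd' hs ht hst, ?_, ?_⟩
    · simp only [Prod.smul_mk, Prod.mk_add_mk]; module
    · have h1 := hφcv.2 hc hc' hs ht hst
      simp only [Prod.smul_mk, Prod.mk_add_mk, smul_eq_mul] at *
      rcases hs.eq_or_lt with rfl | hs'
      · have : t = 1 := by linarith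
        subst this; linarith
      · have := mul_lt_mul_of_pos_left hca hs'
        have := mul_le_mul_of_nonneg_left hca'.le ht
        linarith
  have hPint : ((0 : E), (N + 1 : ℝ)) ∈ interior P := by
    refine mem_interior.2 ⟨Metric.ball 0 δ ×ˢ Set.Ioi (N : ℝ), ?_,
      Metric.isOpen_ball.prod isOpen_Ioi, by simp [hδ]⟩
    rintro ⟨v, a⟩ ⟨hv, ha⟩
    obtain ⟨⟨c, d⟩, ⟨⟨⟨hc, hcN⟩, hd⟩, -⟩, hcd⟩ := hball hv
    exact ⟨c, hc, d, hd, hcd, hcN.trans_lt ha⟩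
  have hP0 : ((0 : E), (0 : ℝ)) ∉ interior P := by
    intro h0
    obtain ⟨c, hc, d, hd, hcd, hlt⟩ := interior_subset h0
    have : c = d := sub_eq_zero.1 hcd
    exact absurd (hφnn c ⟨hc, this ▸ hd⟩) (not_le.2 hlt)
  obtain ⟨f, hf⟩ := geometric_hahn_banach_open_point hPcv.interior isOpen_interior hP0
  have hf' : ∀ z ∈ P, f z ≤ 0 := by
    have hcl : IsClosed {z | f z ≤ 0} := isClosed_le f.continuous continuous_const
    have hsub : closure (interior P) ⊆ {z | f z ≤ 0} := closure_minimal
      (fun z hz => (hf z hz).le.trans_eq (map_zero f)) hcl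
    rw [hPcv.closure_interior_eq_closure_of_nonempty_interior ⟨_, hPint⟩] at hsub
    exact fun z hz => hsub (subset_closure hz)
  set g : StrongDual ℝ E := f.comp (ContinuousLinearMap.inl ℝ E ℝ) with hg
  set β := f (0, 1) with hβ
  have hfz : ∀ v a, f (v, a) = g v + a * β := by
    intro v a
    have : ((v, a) : E × ℝ) = (v, 0) + a • (0, 1) := by simp
    rw [this, map_add, map_smul]; rfl
  have hβneg : β < 0 := by
    have := hf _ hPint
    rw [hfz, hfz, map_zero] at this
    have hN : (0 : ℝ) < N + 1 := by positivity
    by_contra! hc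
    have := mul_nonneg hN.le hc
    linarith
  have hmain : ∀ c ∈ C, ∀ d ∈ D, g (c - d) + φ c * β ≤ 0 := by
    intro c hc d hd
    refine le_of_forall_pos_le_add fun ε hε => ?_
    have h1 := hf' (c - d, φ c + ε / (-β))
      ⟨c, hc, d, hd, rfl, by have := div_pos hε (neg_pos.2 hβneg); simpa using this⟩
    rw [hfz, add_mul, div_mul_eq_mul_div, div_neg, mul_div_assoc, div_self hβneg.ne] at h1
    linarith
  have hinv : 0 < -β⁻¹ := neg_pos.2 (inv_lt_zero.2 hβneg)
  refine ⟨β⁻¹ • g, fun d hd => ?_, fun c hc => ?_⟩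
  · have h1 := hmain 0 hC0 d hd
    rw [hφ0, zero_mul, add_zero, zero_sub, map_neg] at h1
    have := mul_nonneg hinv.le (show 0 ≤ g d by linarith)
    simp only [smul_apply, smul_eq_mul]
    linarith
  · have h1 := hmain c hc 0 hD0
    rw [sub_zero] at h1
    have h2 := mul_le_mul_of_nonneg_left h1 hinv.le
    have h3 : β⁻¹ * (φ c * β) = φ c := by field_simp [hβneg.ne]
    simp only [smul_apply, smul_eq_mul]
    linarith

lemma exists_normal_subgradient {H : Type*} [NormedAddCommGroup H] [InnerProductSpace ℝ H]
    [CompleteSpace H] {C D : Set H} {φ : H → ℝ} {z : H} (V : Submodule ℝ H)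
    (hV : IsClosed (V : Set H))
    (hCDV : {w : H | ∃ t : ℝ, 0 < t ∧ ∃ c ∈ C, ∃ d ∈ D, w = t • (c - d)} = (V : Set H))
    (hCcl : IsClosed C) (hDcl : IsClosed D) (hDcv : Convex ℝ D) (hφcv : ConvexOn ℝ C φ)
    (hφlsc : LowerSemicontinuousOn φ C) (hzC : z ∈ C) (hzD : z ∈ D) (hφz : φ z = 0)
    (hφnn : ∀ v ∈ C ∩ D, 0 ≤ φ v) :
    ∃ p : H, (∀ d ∈ D, ⟪p, d - z⟫ ≤ 0) ∧ ∀ c ∈ C, 0 ≤ φ c + ⟪p, c - z⟫ := by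
  have : CompleteSpace V := hV.completeSpace_coe
  have hCV : ∀ c ∈ C, c - z ∈ V := fun c hc =>
    hCDV.subset ⟨1, one_pos, c, hc, z, hzD, (one_smul _ _).symm⟩
  have hDV : ∀ d ∈ D, d - z ∈ V := fun d hd => by
    have : z - d ∈ V := hCDV.subset ⟨1, one_pos, z, hzC, d, hd, (one_smul _ _).symm⟩
    simpa using V.neg_mem this
  let j : V →ᵃ[ℝ] H := V.subtype.toAffineMap + AffineMap.const ℝ V z
  have hj : ∀ v : V, j v = v + z := fun v => rfl
  have hjc : Continuous j := by
    change Continuous fun v : V => (v : H) + z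
    fun_prop
  obtain ⟨f, hf1, hf2⟩ := exists_dual_of_absorbing (C := j ⁻¹' C) (D := j ⁻¹' D) (φ := φ ∘ j)
    (hCcl.preimage hjc) (hDcl.preimage hjc) (hDcv.affine_preimage j) (hφcv.comp_affineMap j)
    (hφlsc.comp hjc.continuousOn (Set.mapsTo_preimage _ _)) (by simpa [hj]) (by simpa [hj])
    (by simpa [hj]) (fun v hv => hφnn _ hv) (fun v => by
      obtain ⟨t, ht, c, hc, d, hd, h⟩ := hCDV.superset v.2
      exact ⟨t, ht, ⟨c - z, hCV c hc⟩, by simpa [hj], ⟨d - z, hDV d hd⟩, by simpa [hj],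
        Subtype.ext (by simpa using h)⟩)
  set q := (InnerProductSpace.toDual ℝ V).symm f with hq
  have hqf : ∀ v : V, ⟪(q : H), (v : H)⟫ = f v := fun v =>
    InnerProductSpace.toDual_symm_apply (𝕜 := ℝ) (E := V) (x := v) (y := f)
  refine ⟨q, fun d hd => ?_, fun c hc => ?_⟩
  · exact (hqf ⟨d - z, hDV d hd⟩).trans_le (hf1 _ (by simpa [hj]))
  · have h := hf2 ⟨c - z, hCV c hc⟩ (by simpa [hj])
    rw [← hqf] at h
    simpa [hj] using h

section Equilibrium

variable {H : Type*} [NormedAddCommGroup H] [InnerProductSpace ℝ H] {C : Set H} {F : H → H → ℝ}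

lemma equilibrium_iff_dual_equilibrium (hCcv : Convex ℝ C) (hF1 : ∀ x ∈ C, F x x = 0)
    (hF2 : ∀ x ∈ C, ConvexOn ℝ C (F x)) (hF4 : ∀ x ∈ C, ∀ y ∈ C, F x y + F y x ≤ 0)
    (hF5 : ∀ x ∈ C, ∀ y ∈ C, ∀ z ∈ C,
      Filter.limsup (fun t : ℝ => ((F (t • z + (1 - t) • x) y : ℝ) : EReal))
        (nhdsWithin 0 (Set.Ioi 0)) ≤ ((F x y : ℝ) : EReal)) {x : H} (hx : x ∈ C) :
    (∀ y ∈ C, 0 ≤ F x y) ↔ ∀ y ∈ C, F y x ≤ 0 := by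
  refine ⟨fun h y hy => by linarith [h y hy, hF4 x hx y hy], fun h y hy => ?_⟩
  have hev : ∀ᶠ t : ℝ in nhdsWithin 0 (Set.Ioi 0),
      (0 : EReal) ≤ ((F (t • y + (1 - t) • x) y : ℝ) : EReal) := by
    filter_upwards [Ioo_mem_nhdsGT (one_pos : (0 : ℝ) < 1)] with t ht
    have ht' : 0 ≤ 1 - t := by linarith [ht.2]
    have hz : t • y + (1 - t) • x ∈ C := hCcv hy hx ht.1.le ht' (by ring)
    have h1 := (hF2 _ hz).2 hy hx ht.1.le ht' (by ring)
    rw [hF1 _ hz, smul_eq_mul, smul_eq_mul] at h1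
    have h2 := mul_nonpos_of_nonneg_of_nonpos ht' (h _ hz)
    exact_mod_cast nonneg_of_mul_nonneg_right (by linarith : 0 ≤ t * _) ht.1
  exact_mod_cast (le_limsup_of_frequently_le hev.frequently).trans (hF5 x hx y hy y hy)

lemma isClosed_convex_dual_equilibrium (hCcl : IsClosed C) (hCcv : Convex ℝ C)
    (hF2 : ∀ x ∈ C, ConvexOn ℝ C (F x)) (hF3 : ∀ x ∈ C, LowerSemicontinuousOn (F x) C) :
    IsClosed {x | x ∈ C ∧ ∀ y ∈ C, F y x ≤ 0} ∧ Convex ℝ {x | x ∈ C ∧ ∀ y ∈ C, F y x ≤ 0} := by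
  have : {x | x ∈ C ∧ ∀ y ∈ C, F y x ≤ 0} = C ∩ ⋂ y ∈ C, {x | x ∈ C ∧ F y x ≤ 0} := by
    ext x
    simp only [Set.mem_ofPred_eq, Set.mem_inter_iff, Set.mem_iInter]
    exact ⟨fun h => ⟨h.1, fun y hy => ⟨h.1, h.2 y hy⟩⟩, fun h => ⟨h.1, fun y hy => (h.2 y hy).2⟩⟩
  rw [this]
  refine ⟨hCcl.inter (isClosed_biInter fun y hy => ?_),
    hCcv.inter (convex_iInter₂ fun y hy => (hF2 y hy).convex_le 0)⟩
  obtain ⟨v, hv, hCv⟩ := lowerSemicontinuousOn_iff_preimage_Iic.1 (hF3 y hy) 0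
  have : {x | x ∈ C ∧ F y x ≤ 0} = C ∩ v := hCv
  rw [this]
  exact hCcl.inter hv

end Equilibrium

lemma norm_sq_sub_le_of_resolvent {H : Type*} [NormedAddCommGroup H] [InnerProductSpace ℝ H]
    {a x z : H} {b : ℝ} (h : 0 ≤ b + ⟪a - z, z - x⟫) :
    ‖z - a‖ ^ 2 ≤ ‖x - a‖ ^ 2 - ‖z - x‖ ^ 2 + 2 * b := by
  have h1 : ‖x - a‖ ^ 2 = ‖(z - a) - (z - x)‖ ^ 2 := by congr 2; abel
  rw [h1, norm_sub_sq_real (z - a)]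
  have h2 : ⟪a - z, z - x⟫ = -⟪z - a, z - x⟫ := by rw [← inner_neg_left, neg_sub]
  rw [h2] at h
  linarith

/-- One step of the splitting scheme, with the two resolvent inequalities combined. -/
lemma splitting_step {H : Type*} [NormedAddCommGroup H] [InnerProductSpace ℝ H]
    {xb p x x' y u v : H} {γ r ρ lam g f ω : ℝ} (hγ : γ ∈ Set.Icc (0 : ℝ) (1 / 2))
    (hr : 0 < r) (hρ : 0 < ρ) (hrρ : 2 * ρ * r ≤ 1 / 2)
    (hy : y = (1 - γ) • x + γ • x') (hu : 0 ≤ r * g + ⟪xb - u, u - y⟫)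
    (hx : 0 ≤ (r * lam) * f + ⟪xb - v, v - u⟫)
    (hg : g ≤ ⟪p, u - xb⟫ - ρ * ‖u - xb‖ ^ 2)
    (hf : lam * f ≤ lam * ω - ⟪p, v - xb⟫) :
    (1 + ρ * r) * ‖v - xb‖ ^ 2 ≤ (1 - γ) * ‖x - xb‖ ^ 2 + γ * ‖x' - xb‖ ^ 2 +
      r * (2 * ‖p‖ ^ 2 * r + 2 * (lam * ω)) := by
  have h1 := norm_sq_sub_le_of_resolvent hu
  have h2 := norm_sq_sub_le_of_resolvent hx
  have hyb : ‖y - xb‖ ^ 2 ≤ (1 - γ) * ‖x - xb‖ ^ 2 + γ * ‖x' - xb‖ ^ 2 := by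
    have hc := (convexOn_norm (convex_univ (𝕜 := ℝ) (E := H))).pow (fun _ _ => norm_nonneg _) 2
    have := hc.2 (Set.mem_univ (x - xb)) (Set.mem_univ (x' - xb))
      (by linarith [hγ.2] : 0 ≤ 1 - γ) hγ.1 (by ring)
    have e : y - xb = (1 - γ) • (x - xb) + γ • (x' - xb) := by rw [hy]; module
    rw [e]
    simpa using this
  have hin : ⟪p, u - xb⟫ - ⟪p, v - xb⟫ ≤ ‖p‖ * ‖v - u‖ := by
    rw [← inner_sub_right, sub_sub_sub_cancel_right, norm_sub_rev]
    exact real_inner_le_norm _ _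
  have htri : ‖v - xb‖ ^ 2 ≤ 2 * ‖v - u‖ ^ 2 + 2 * ‖u - xb‖ ^ 2 := by
    have h := norm_sub_le_norm_sub_add_norm_sub v u xb
    nlinarith [sq_nonneg (‖v - u‖ - ‖u - xb‖), norm_nonneg (v - xb)]
  have hg' := mul_le_mul_of_nonneg_left hg hr.le
  have hf' := mul_le_mul_of_nonneg_left hf hr.le
  have hin' := mul_le_mul_of_nonneg_left hin hr.le
  have htri' := mul_le_mul_of_nonneg_left htri (mul_nonneg hρ.le hr.le)
  have hrest := mul_le_mul_of_nonneg_right hrρ (sq_nonneg ‖v - u‖)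
  nlinarith [sq_nonneg (2 * r * ‖p‖ - ‖v - u‖), sq_nonneg ‖u - y‖]

/-- Theorem 2: with `F` satisfying (C1)-(C5), `G` satisfying (C1)-(C3) and
`ρ`-strongly monotone (`ρ > 0`), `S` nonempty, assumptions (H2), (H3), parameters
`∑ r_k = +∞`, `∑ r_k² < +∞`, `γ_k ∈ [0, 1/2]`, and the geometric condition (H5), the
hierarchical solution set `S` is a singleton `{x̄}` and the sequence generated by the
splitting algorithm converges strongly to `x̄`. -/
theorem ripsa_strong_convergence_strongly_monotone
    {H : Type*} [NormedAddCommGroup H] [InnerProductSpace ℝ H] [CompleteSpace H]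
    (C : Set H) (hCne : C.Nonempty) (hCcl : IsClosed C) (hCcv : Convex ℝ C)
    (F G : H → H → ℝ)
    -- (C1)-(C5) for F
    (hF1 : ∀ x ∈ C, F x x = 0)
    (hF2 : ∀ x ∈ C, ConvexOn ℝ C (F x))
    (hF3 : ∀ x ∈ C, LowerSemicontinuousOn (F x) C)
    (hF4 : ∀ x ∈ C, ∀ y ∈ C, F x y + F y x ≤ 0)
    (hF5 : ∀ x ∈ C, ∀ y ∈ C, ∀ z ∈ C,
      Filter.limsup (fun t : ℝ => ((F (t • z + (1 - t) • x) y : ℝ) : EReal))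
        (nhdsWithin 0 (Set.Ioi 0)) ≤ ((F x y : ℝ) : EReal))
    -- (C1)-(C3) for G, and strong monotonicity
    (hG1 : ∀ x ∈ C, G x x = 0)
    (hG2 : ∀ x ∈ C, ConvexOn ℝ C (G x))
    (hG3 : ∀ x ∈ C, LowerSemicontinuousOn (G x) C)
    (ρ : ℝ) (hρ : 0 < ρ)
    (hGstrong : ∀ x ∈ C, ∀ y ∈ C, G x y + G y x ≤ -ρ * ‖x - y‖ ^ 2)
    -- solution sets
    (SF : Set H) (hSF : SF = {x | x ∈ C ∧ ∀ y ∈ C, 0 ≤ F x y})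
    (S : Set H) (hS : S = {x | x ∈ SF ∧ ∀ y ∈ SF, 0 ≤ G x y})
    (hSne : S.Nonempty)
    -- (H2)
    (hH2 : ∀ x ∈ C, ∃ ξ : H, ∀ u ∈ C, ⟪ξ, u - x⟫ ≤ G x u)
    -- (H3)
    (hH3 : ∃ V : Submodule ℝ H, IsClosed (V : Set H) ∧
      {w : H | ∃ t : ℝ, 0 < t ∧ ∃ c ∈ C, ∃ s ∈ SF, w = t • (c - s)} = (V : Set H))
    -- parameters
    (r lam γ : ℕ → ℝ)
    (hr_pos : ∀ k, 0 < r k)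
    (hr_div : Tendsto (fun n : ℕ => ∑ k ∈ Finset.Icc 1 n, r k) atTop atTop)
    (hr_sq : Summable (fun k => (r k) ^ 2))
    (hlam_pos : ∀ k, 0 < lam k)
    (hγ : ∀ k, γ k ∈ Set.Icc (0 : ℝ) (1 / 2))
    -- geometric condition (H5)
    (hH5 : ∀ xb ∈ S, ∀ p : H, (∀ w ∈ SF, ⟪p, w - xb⟫ ≤ 0) →
      ∃ ω : ℕ → ℝ, (∀ k, 0 ≤ ω k) ∧
        Filter.limsup (fun k : ℕ => ((lam k * ω k : ℝ) : EReal)) atTop ≤ 0 ∧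
        ∀ k, ∀ v ∈ C, F v xb + (2 / lam k) * ⟪p, v - xb⟫ ≤ ω k)
    -- the algorithm
    (x u y : ℕ → H)
    (hx0 : x 0 ∈ C) (hx1 : x 1 ∈ C)
    (hy : ∀ k ≥ 1, y k = (1 - γ k) • x k + γ k • x (k - 1))
    (hu : ∀ k ≥ 1, u k ∈ C ∧ ∀ w ∈ C, 0 ≤ r k * G (u k) w + ⟪w - u k, u k - y k⟫)
    (hxsucc : ∀ k ≥ 1, x (k + 1) ∈ C ∧
      ∀ w ∈ C, 0 ≤ (r k * lam k) * F (x (k + 1)) w + ⟪w - x (k + 1), x (k + 1) - u k⟫) :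
    ∃ xbar : H, S = {xbar} ∧ Tendsto x atTop (nhds xbar) := by
  subst hSF hS
  obtain ⟨xb, hxb⟩ := hSne
  have hxbC : xb ∈ C := hxb.1.1
  have hSF' : {x | x ∈ C ∧ ∀ y ∈ C, 0 ≤ F x y} = {x | x ∈ C ∧ ∀ y ∈ C, F y x ≤ 0} :=
    Set.ext fun z => and_congr_right fun hz =>
      equilibrium_iff_dual_equilibrium hCcv hF1 hF2 hF4 hF5 hz
  obtain ⟨hcl, hcv⟩ := isClosed_convex_dual_equilibrium hCcl hCcv hF2 hF3
  rw [← hSF'] at hcl hcv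
  refine ⟨xb, Set.Subset.antisymm (fun z hz => ?_) (Set.singleton_subset_iff.2 hxb), ?_⟩
  · have h1 := hGstrong z hz.1.1 xb hxbC
    have h2 := hz.2 xb hxb.1
    have h3 := hxb.2 z hz.1
    have h4 : ‖z - xb‖ ^ 2 = 0 :=
      le_antisymm (nonpos_of_mul_nonpos_right (by linarith : ρ * ‖z - xb‖ ^ 2 ≤ 0) hρ)
        (sq_nonneg _)
    exact sub_eq_zero.1 (norm_eq_zero.1 (pow_eq_zero_iff two_ne_zero |>.1 h4))
  obtain ⟨V, hV, hCV⟩ := hH3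
  obtain ⟨p, hp1, hp2⟩ := exists_normal_subgradient V hV hCV hCcl hcl hcv (hG2 xb hxbC)
    (hG3 xb hxbC) hxbC hxb.1 (hG1 xb hxbC) fun v hv => hxb.2 v hv.2
  obtain ⟨ω, hω0, hωlim, hω⟩ := hH5 xb hxb ((1 / 2 : ℝ) • p) fun w hw => by
    rw [real_inner_smul_left]; linarith [hp1 w hw]
  have hr0 : Tendsto r atTop (nhds 0) := by
    have := hr_sq.tendsto_atTop_zero.sqrt
    simpa only [Real.sqrt_sq (hr_pos _).le, Real.sqrt_zero] using this
  have hrs : ¬ Summable r := fun hs => by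
    obtain ⟨n, hn⟩ := (hr_div.eventually_gt_atTop (∑' k, r k)).exists
    exact absurd (hs.sum_le_tsum _ fun k _ => (hr_pos k).le) (not_le.2 hn)
  have hlamω : ∀ δ > 0, ∀ᶠ k in atTop, lam k * ω k < δ := fun δ hδ => by
    filter_upwards [eventually_lt_of_limsup_lt (hωlim.trans_lt (EReal.coe_pos.2 hδ))] with k hk
    exact_mod_cast hk
  have key : Tendsto (fun k => ‖x k - xb‖ ^ 2) atTop (nhds 0) := by
    refine tendsto_zero_of_two_step_perturbed (r := fun k => r (k + 1))
      (γ := fun k => γ (k + 1))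
      (ε := fun k => 2 * ‖p‖ ^ 2 * r (k + 1) + 2 * (lam (k + 1) * ω (k + 1)))
      hρ (fun k => sq_nonneg _) (fun k => (hr_pos _).le)
      (fun hs => hrs ((summable_nat_add_iff 1).1 hs)) (fun k => hγ _) (fun δ hδ => ?_) ?_
    · have h1 : Tendsto (fun k => 2 * ‖p‖ ^ 2 * r k) atTop (nhds 0) := by
        simpa using hr0.const_mul (2 * ‖p‖ ^ 2)
      refine (tendsto_add_atTop_nat 1).eventually
        (p := fun k => 2 * ‖p‖ ^ 2 * r k + 2 * (lam k * ω k) ≤ δ) ?_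
      filter_upwards [h1.eventually (gt_mem_nhds (half_pos hδ)), hlamω (δ / 4) (by positivity)]
        with k hk1 hk2
      linarith
    · have h1 : Tendsto (fun k => 2 * ρ * r k) atTop (nhds 0) := by
        simpa using hr0.const_mul (2 * ρ)
      filter_upwards [(tendsto_add_atTop_nat 1).eventually
        (h1.eventually (gt_mem_nhds (half_pos one_pos)))] with k hk
      have hk1 : k + 1 ≥ 1 := by omega
      obtain ⟨huC, hu'⟩ := hu (k + 1) hk1
      obtain ⟨hxC, hx'⟩ := hxsucc (k + 1) hk1
      refine splitting_step (hγ _) (hr_pos _) hρ hk.le (hy (k + 1) hk1)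
        (hu' xb hxbC) (hx' xb hxbC) ?_ ?_
      · linarith [hGstrong _ huC _ hxbC, hp2 _ huC]
      · have h2 := mul_le_mul_of_nonneg_left (hω (k + 1) _ hxC) (hlam_pos (k + 1)).le
        have h3 : lam (k + 1) * (2 / lam (k + 1) * ⟪(1 / 2 : ℝ) • p, x (k + 1 + 1) - xb⟫) =
            ⟪p, x (k + 1 + 1) - xb⟫ := by
          rw [real_inner_smul_left]
          field_simp [(hlam_pos (k + 1)).ne']
        rw [mul_add, h3] at h2
        linarith
  rw [tendsto_iff_norm_sub_tendsto_zero]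
  have := key.sqrt
  simpa only [Real.sqrt_sq (norm_nonneg _), Real.sqrt_zero] using this
end
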